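/- Let f : (R, m, k) → (S, n, ℓ) be a flat local homomorphism of commutative Noetherian local rings with mS = n, and let N be a finitely generated S-module. Then for all i ≥ 0, Tor_i^R(k, N) ≅ Tor_i^S(ℓ, N) as abelian groups; consequently the flat dimension of N over R equals its projective dimension over S. -/

import Mathlib

open CategoryTheory IsLocalRing

/-- Restriction of scalars along `f : R →+* S`: the carrier is `B`, with `r • b = f r • b`. -/
def Restrict {R S : Type} [CommRing R] [CommRing S] (f : R →+* S)
    (B : Type) [AddCommGroup B] [Module S B] : Type := B

instance {R S : Type} [CommRing R] [CommRing S] (f : R →+* S)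
    (B : Type) [AddCommGroup B] [Module S B] : AddCommGroup (Restrict f B) :=
  inferInstanceAs (AddCommGroup B)

instance {R S : Type} [CommRing R] [CommRing S] (f : R →+* S)
    (B : Type) [AddCommGroup B] [Module S B] : Module R (Restrict f B) :=
  Module.compHom B f

/-- `Tor_n^A(X, Y)`. -/
noncomputable def torGroup (A : Type) [CommRing A] (n : ℕ)
    (X Y : Type) [AddCommGroup X] [Module A X] [AddCommGroup Y] [Module A Y] : ModuleCat A :=
  ((Tor (ModuleCat A) n).obj (ModuleCat.of A X)).obj (ModuleCat.of A Y)

/-- `fd_A Y ≤ n`, via vanishing of `Tor_i^A(X, Y)` for all `X` and `i > n`. -/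
noncomputable def flatDimLE (A : Type) [CommRing A]
    (Y : Type) [AddCommGroup Y] [Module A Y] (n : ℕ) : Prop :=
  ∀ (X : ModuleCat A) (i : ℕ), n < i →
    Subsingleton (((Tor (ModuleCat A) i).obj X).obj (ModuleCat.of A Y))

/-- `pd_A Y ≤ n`, via vanishing of `Ext^i_A(Y, X)` for all `X` and `i > n`. -/
noncomputable def projDimLE (A : Type) [CommRing A]
    (Y : Type) [AddCommGroup Y] [Module A Y] (n : ℕ) : Prop :=
  ∀ (X : ModuleCat A) (i : ℕ), n < i →
    Subsingleton (((Ext A (ModuleCat A) i).obj (Opposite.op (ModuleCat.of A Y))).obj X)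

section Aux
open MonoidalCategory

/-- complexes -/
noncomputable abbrev tsc {A : Type} [CommRing A] (S : ShortComplex (ModuleCat.{0} A))
    (K : ChainComplex (ModuleCat.{0} A) ℕ) : ShortComplex (ChainComplex (ModuleCat.{0} A) ℕ) where
  X₁ := (((tensoringLeft (ModuleCat.{0} A)).obj S.X₁).mapHomologicalComplex _).obj K
  X₂ := (((tensoringLeft (ModuleCat.{0} A)).obj S.X₂).mapHomologicalComplex _).obj K
  X₃ := (((tensoringLeft (ModuleCat.{0} A)).obj S.X₃).mapHomologicalComplex _).obj K
  f := (NatTrans.mapHomologicalComplex ((tensoringLeft _).map S.f) _).app K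
  g := (NatTrans.mapHomologicalComplex ((tensoringLeft _).map S.g) _).app K
  zero := by
    ext i : 1
    have h : S.f ▷ K.X i ≫ S.g ▷ K.X i = 0 := by
      rw [← comp_whiskerRight, S.zero, MonoidalPreadditive.zero_whiskerRight]
    exact h

lemma flat_of_projective' {A : Type} [CommRing A] (Y : ModuleCat.{0} A) [Projective Y] :
    Module.Flat A Y := by
  have : Module.Projective A Y := (IsProjective.iff_projective Y).2 inferInstance
  infer_instance

lemma tsc_shortExact {A : Type} [CommRing A] {S : ShortComplex (ModuleCat.{0} A)}
    (hS : S.ShortExact) (K : ChainComplex (ModuleCat.{0} A) ℕ) [∀ i, Projective (K.X i)] :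
    (tsc S K).ShortExact := by
  apply HomologicalComplex.shortExact_of_degreewise_shortExact
  intro i
  have := flat_of_projective' (K.X i)
  exact hS.map_of_exact (tensorRight (K.X i))

lemma tsc_zero {A : Type} [CommRing A] (X : ModuleCat.{0} A) [Module.Flat A X] (Y : ModuleCat.{0} A)
    (P : ProjectiveResolution Y) (i : ℕ) :
    Limits.IsZero (((((tensoringLeft (ModuleCat.{0} A)).obj X).mapHomologicalComplex _).obj
      P.complex).homology (i + 1)) := by
  rw [← HomologicalComplex.exactAt_iff_isZero_homology]
  refine (HomologicalComplex.exactAt_iff' _ (i + 2) (i + 1) i (by simp) (by simp)).2 ?_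
  have h := P.exact_succ i
  rw [ShortComplex.ShortExact.moduleCat_exact_iff_function_exact] at h ⊢
  exact Module.Flat.lTensor_exact X h

lemma tor_shift {A : Type} [CommRing A] {S : ShortComplex (ModuleCat.{0} A)}
    (hS : S.ShortExact) [Module.Flat A S.X₂] (Y : ModuleCat.{0} A) (i : ℕ) :
    Nonempty (((Tor (ModuleCat A) (i + 2)).obj S.X₃).obj Y ≅
      ((Tor (ModuleCat A) (i + 1)).obj S.X₁).obj Y) := by
  let P := ProjectiveResolution.of Y
  have h := tsc_shortExact hS P.complex
  exact ⟨P.isoLeftDerivedObj _ _ ≪≫ h.δIso (i + 2) (i + 1) (by simp) (tsc_zero _ _ P _)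
    (tsc_zero _ _ P _) ≪≫ (P.isoLeftDerivedObj _ _).symm⟩

noncomputable def tor0iso {A : Type} [CommRing A] (X : ModuleCat.{0} A) {Y : ModuleCat.{0} A}
    (P : ProjectiveResolution Y) :
    ((((tensoringLeft (ModuleCat.{0} A)).obj X).mapHomologicalComplex _).obj
      P.complex).homology 0 ≅ X ⊗ Y :=
  (ChainComplex.isoHomologyι₀ _) ≪≫
    (haveI : Limits.PreservesFiniteColimits ((tensoringLeft (ModuleCat.{0} A)).obj X) :=
      inferInstanceAs (Limits.PreservesFiniteColimits (tensorLeft X))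
     asIso (P.fromLeftDerivedZero' ((tensoringLeft (ModuleCat.{0} A)).obj X)))

lemma tor0iso_nat {A : Type} [CommRing A] {X X' : ModuleCat.{0} A} (f : X ⟶ X')
    {Y : ModuleCat.{0} A} (P : ProjectiveResolution Y) :
    HomologicalComplex.homologyMap
      ((NatTrans.mapHomologicalComplex ((tensoringLeft _).map f) _).app P.complex) 0 ≫
      (tor0iso X' P).hom = (tor0iso X P).hom ≫ f ▷ Y := by
  simp only [tor0iso, Iso.trans_hom, asIso_hom, Category.assoc]
  simp only [ChainComplex.isoHomologyι₀, HomologicalComplex.isoHomologyι_hom]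
  rw [HomologicalComplex.homologyι_naturality_assoc]
  congr 1
  rw [← cancel_epi (HomologicalComplex.pOpcycles _ _)]
  rw [HomologicalComplex.p_opcyclesMap_assoc]
  simp only [ProjectiveResolution.pOpcycles_comp_fromLeftDerivedZero',
    ProjectiveResolution.pOpcycles_comp_fromLeftDerivedZero'_assoc]
  exact (whisker_exchange _ _).symm

lemma tor_zero {A : Type} [CommRing A] (X Y : ModuleCat.{0} A) :
    Nonempty (((Tor (ModuleCat A) 0).obj X).obj Y ≅ X ⊗ Y) :=
  ⟨(ProjectiveResolution.of Y).isoLeftDerivedObj _ _ ≪≫ tor0iso X _⟩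

lemma tor_one {A : Type} [CommRing A] {S : ShortComplex (ModuleCat.{0} A)}
    (hS : S.ShortExact) [Module.Flat A S.X₂] (Y : ModuleCat.{0} A) :
    Nonempty (((Tor (ModuleCat A) 1).obj S.X₃).obj Y ≃ₗ[A]
      LinearMap.ker (S.f.hom.rTensor Y)) := by
  let P := ProjectiveResolution.of Y
  have h := tsc_shortExact hS P.complex
  have hm := h.mono_δ 1 0 (by simp) (tsc_zero _ _ P _)
  have he := h.homology_exact₁ 1 0 (by simp)
  let δ := h.δ 1 0 (by simp) ≫ (tor0iso S.X₁ P).hom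
  have hδ : δ ≫ S.f ▷ Y = 0 := by
    have h1 := tor0iso_nat S.f P
    have h2 := h.δ_comp 1 0 (by simp)
    calc _ = h.δ 1 0 (by simp) ≫ (tor0iso S.X₁ P).hom ≫ S.f ▷ Y := Category.assoc _ _ _
      _ = h.δ 1 0 (by simp) ≫ HomologicalComplex.homologyMap (tsc S P.complex).f 0 ≫
          (tor0iso S.X₂ P).hom := by rw [← h1]
      _ = 0 := by rw [reassoc_of% h2, Limits.zero_comp]
  have hex : (ShortComplex.mk δ (S.f ▷ Y) hδ).Exact := by
    refine (ShortComplex.exact_iff_of_iso ?_).1 he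
    exact ShortComplex.isoMk (Iso.refl _) (tor0iso S.X₁ P) (tor0iso S.X₂ P) (by simp [δ])
      (tor0iso_nat S.f P).symm
  have hmono : Mono δ := by
    have : Mono (tor0iso S.X₁ P).hom := inferInstance
    exact mono_comp _ _
  have hinj : Function.Injective δ.hom := (ModuleCat.mono_iff_injective _).1 hmono
  have hr : LinearMap.range δ.hom = LinearMap.ker (S.f.hom.rTensor Y) :=
    (ShortComplex.moduleCat_exact_iff_range_eq_ker _).1 hex
  exact ⟨(P.isoLeftDerivedObj _ _).toLinearEquiv ≪≫ₗ LinearEquiv.ofInjective _ hinj ≪≫ₗ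
    LinearEquiv.ofEq _ _ hr⟩

lemma tor_subsingleton_iff {A : Type} [CommRing A] (X : ModuleCat.{0} A) {Y : ModuleCat.{0} A}
    (P : ProjectiveResolution Y) (j : ℕ) :
    Subsingleton (((Tor (ModuleCat A) (j + 1)).obj X).obj Y) ↔
      Function.Exact ((P.complex.d (j + 2) (j + 1)).hom.lTensor X)
        ((P.complex.d (j + 1) j).hom.lTensor X) := by
  have e := P.isoLeftDerivedObj ((tensoringLeft (ModuleCat.{0} A)).obj X) (j + 1)
  have e' : Subsingleton (((Tor (ModuleCat A) (j + 1)).obj X).obj Y) ↔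
      Limits.IsZero (((((tensoringLeft (ModuleCat.{0} A)).obj X).mapHomologicalComplex _).obj
      P.complex).homology (j + 1)) :=
    (e.toLinearEquiv.toEquiv.subsingleton_congr).trans ModuleCat.isZero_iff_subsingleton.symm
  rw [e', ← HomologicalComplex.exactAt_iff_isZero_homology]
  refine (HomologicalComplex.exactAt_iff' _ (j + 2) (j + 1) j (by simp) (by simp)).trans ?_
  rw [ShortComplex.ShortExact.moduleCat_exact_iff_function_exact]
  rfl

lemma ext_subsingleton_iff {A : Type} [CommRing A] (X : ModuleCat.{0} A) {Y : ModuleCat.{0} A}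
    (P : ProjectiveResolution Y) (j : ℕ) :
    Subsingleton (((Ext A (ModuleCat A) (j + 1)).obj (Opposite.op Y)).obj X) ↔
      ∀ φ : P.complex.X (j + 1) ⟶ X, P.complex.d (j + 2) (j + 1) ≫ φ = 0 →
        ∃ ψ : P.complex.X j ⟶ X, P.complex.d (j + 1) j ≫ ψ = φ := by
  have e := P.isoExt (R := A) (j + 1) X
  rw [e.toLinearEquiv.toEquiv.subsingleton_congr, ← ModuleCat.isZero_iff_subsingleton,
    ← HomologicalComplex.exactAt_iff_isZero_homology]
  refine (HomologicalComplex.exactAt_iff' _ j (j + 1) (j + 2) (by simp) (by simp)).trans ?_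
  rw [ShortComplex.moduleCat_exact_iff]
  rfl

lemma fexact {A : Type} [CommRing A] {Y : ModuleCat.{0} A}
    (P : ProjectiveResolution Y) (j : ℕ) :
    Function.Exact (P.complex.d (j + 2) (j + 1)).hom (P.complex.d (j + 1) j).hom :=
  (ShortComplex.ShortExact.moduleCat_exact_iff_function_exact _).1 (P.exact_succ j)

lemma tor_of_ext {A : Type} [CommRing A] (Y : ModuleCat.{0} A) (j : ℕ)
    (h : ∀ X : ModuleCat.{0} A,
      Subsingleton (((Ext A (ModuleCat A) (j + 1)).obj (Opposite.op Y)).obj X))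
    (X : ModuleCat.{0} A) :
    Subsingleton (((Tor (ModuleCat A) (j + 1)).obj X).obj Y) := by
  let P := ProjectiveResolution.of Y
  rw [tor_subsingleton_iff X P]
  set d' := (P.complex.d (j + 1) j).hom with hd'
  set d := (P.complex.d (j + 2) (j + 1)).hom with hd
  have hex : Function.Exact d d' := fexact P j
  let K := LinearMap.range d'
  let q : P.complex.X (j + 1) →ₗ[A] K := d'.rangeRestrict
  have hq : Function.Surjective q := LinearMap.surjective_rangeRestrict _
  have hdq : Function.Exact d q := by
    intro x
    rw [← hex x]
    simp [q, Subtype.ext_iff]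
  obtain ⟨ψ, hψ⟩ := (ext_subsingleton_iff (ModuleCat.of A K) P j).1 (h _) (ModuleCat.ofHom q) (by
    ext x
    exact congrArg Subtype.val ((hdq (d x)).2 ⟨x, rfl⟩))
  have hψ' : ψ.hom ∘ₗ K.subtype = LinearMap.id := by
    ext ⟨_, x, rfl⟩
    exact congrArg Subtype.val (ConcreteCategory.congr_hom hψ x)
  have hinj : Function.Injective (K.subtype.lTensor X) := by
    apply Function.LeftInverse.injective (g := ψ.hom.lTensor X)
    intro z
    rw [← LinearMap.comp_apply, ← LinearMap.lTensor_comp, hψ', LinearMap.lTensor_id]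
    rfl
  have h1 := lTensor_exact X hdq hq
  intro z
  rw [← h1 z]
  have : d' = K.subtype ∘ₗ q := rfl
  rw [this, LinearMap.lTensor_comp, LinearMap.comp_apply]
  exact ⟨fun hz => hinj (by rw [hz, map_zero]), fun hz => by rw [hz, map_zero]⟩

lemma ext_of_tor {A : Type} [CommRing A] [IsNoetherianRing A] [IsLocalRing A]
    {Y : ModuleCat.{0} A} (P : ProjectiveResolution Y)
    (hP : ∀ i, Module.Finite A (P.complex.X i)) (hP' : ∀ i, Module.Free A (P.complex.X i)) (j : ℕ)
    (h : Subsingleton (((Tor (ModuleCat A) (j + 1)).obj (ModuleCat.of A (ResidueField A))).obj Y))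
    (X : ModuleCat.{0} A) :
    Subsingleton (((Ext A (ModuleCat A) (j + 1)).obj (Opposite.op Y)).obj X) := by
  rw [tor_subsingleton_iff _ P] at h
  rw [ext_subsingleton_iff _ P]
  set d' := (P.complex.d (j + 1) j).hom with hd'
  set d := (P.complex.d (j + 2) (j + 1)).hom with hd
  have hex : Function.Exact d d' := fexact P j
  let K := LinearMap.range d'
  let q : P.complex.X (j + 1) →ₗ[A] K := d'.rangeRestrict
  have hq : Function.Surjective q := LinearMap.surjective_rangeRestrict _
  have hdq : Function.Exact d q := by
    intro x
    rw [← hex x]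
    simp [q, Subtype.ext_iff]
  have hqd : d' = K.subtype ∘ₗ q := rfl
  have hinj : Function.Injective (K.subtype.lTensor (ResidueField A)) := by
    rw [injective_iff_map_eq_zero]
    intro z hz
    obtain ⟨w, rfl⟩ := LinearMap.lTensor_surjective (ResidueField A) hq z
    rw [← LinearMap.comp_apply, ← LinearMap.lTensor_comp, ← hqd] at hz
    obtain ⟨v, rfl⟩ := (h w).1 hz
    exact (lTensor_exact (ResidueField A) hdq hq _).2 ⟨v, rfl⟩
  obtain ⟨ψ, hψ⟩ := (IsLocalRing.split_injective_iff_lTensor_residueField_injective K.subtype).2 hinj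
  intro φ hφ
  have hker : LinearMap.ker q ≤ LinearMap.ker φ.hom := by
    intro x hx
    obtain ⟨y, rfl⟩ := (hdq x).1 hx
    exact ConcreteCategory.congr_hom hφ y
  let e := LinearMap.quotKerEquivOfSurjective q hq
  let φ' : K →ₗ[A] X := (LinearMap.ker q).liftQ φ.hom hker ∘ₗ e.symm.toLinearMap
  refine ⟨ModuleCat.ofHom (φ' ∘ₗ ψ), ?_⟩
  ext x
  have h1 : ψ (d' x) = q x := LinearMap.congr_fun hψ (q x)
  have h2 : e.symm (q x) = Submodule.Quotient.mk x := by
    rw [LinearEquiv.symm_apply_eq]; rfl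
  change φ' (ψ (d' x)) = φ.hom x
  rw [h1]
  change (LinearMap.ker q).liftQ φ.hom hker (e.symm (q x)) = _
  rw [h2]
  rfl

lemma exists_cover {A : Type} [CommRing A] (M : ModuleCat.{0} A) :
    ∃ (Q : ModuleCat.{0} A) (π : Q ⟶ M), Projective Q ∧ Epi π ∧ Module.Free A Q ∧
      (Module.Finite A M → Module.Finite A Q) := by
  by_cases h : Module.Finite A M
  · obtain ⟨n, f, hf⟩ := Module.Finite.exists_fin' A M
    refine ⟨ModuleCat.of A (Fin n → A), ModuleCat.ofHom f, ?_, ?_, ?_, ?_⟩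
    · exact (IsProjective.iff_projective _).1 inferInstance
    · exact (ModuleCat.epi_iff_surjective _).2 hf
    · infer_instance
    · intro; infer_instance
  · refine ⟨ModuleCat.of A (M →₀ A), ModuleCat.ofHom (Finsupp.linearCombination A id), ?_, ?_, ?_, ?_⟩
    · exact (IsProjective.iff_projective _).1 inferInstance
    · exact (ModuleCat.epi_iff_surjective _).2 (Finsupp.linearCombination_id_surjective A M)
    · infer_instance
    · intro h'; exact absurd h' h

noncomputable def cov {A : Type} [CommRing A] (M : ModuleCat.{0} A) : ModuleCat.{0} A :=
  (exists_cover M).choose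
noncomputable def covπ {A : Type} [CommRing A] (M : ModuleCat.{0} A) : cov M ⟶ M :=
  (exists_cover M).choose_spec.choose
lemma cov_spec {A : Type} [CommRing A] (M : ModuleCat.{0} A) :
    Projective (cov M) ∧ Epi (covπ M) ∧ Module.Free A (cov M) ∧
      (Module.Finite A M → Module.Finite A (cov M)) :=
  (exists_cover M).choose_spec.choose_spec
instance {A : Type} [CommRing A] (M : ModuleCat.{0} A) : Epi (covπ M) := (cov_spec M).2.1

open Limits in
noncomputable def covd {A : Type} [CommRing A] {X Y : ModuleCat.{0} A} (f : X ⟶ Y) :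
    cov (kernel f) ⟶ X := covπ (kernel f) ≫ kernel.ι f

lemma covd_comp {A : Type} [CommRing A] {X Y : ModuleCat.{0} A} (f : X ⟶ Y) :
    covd f ≫ f = 0 := by simp [covd]

open Limits in
lemma covd_exact {A : Type} [CommRing A] {X Y : ModuleCat.{0} A} (f : X ⟶ Y) :
    (ShortComplex.mk (covd f) f (covd_comp f)).Exact := by
  let α : ShortComplex.mk (covd f) f (covd_comp f) ⟶
      ShortComplex.mk (kernel.ι f) f (by simp) :=
    { τ₁ := covπ _
      τ₂ := 𝟙 _
      τ₃ := 𝟙 _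
      comm₁₂ := by simp [covd] }
  have : Epi α.τ₁ := by dsimp [α]; infer_instance
  have : IsIso α.τ₂ := by dsimp [α]; infer_instance
  have : Mono α.τ₃ := by dsimp [α]; infer_instance
  rw [ShortComplex.exact_iff_of_epi_of_isIso_of_mono α]
  apply ShortComplex.exact_of_f_is_kernel
  apply kernelIsKernel

noncomputable def covComplex {A : Type} [CommRing A] (Z : ModuleCat.{0} A) :
    ChainComplex (ModuleCat.{0} A) ℕ :=
  ChainComplex.mk' (cov Z) (cov (Limits.kernel (covπ Z))) (covd (covπ Z))
    (fun f => ⟨_, covd f, covd_comp f⟩)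

lemma covComplex_d {A : Type} [CommRing A] (Z : ModuleCat.{0} A) :
    (covComplex Z).d 1 0 = covd (covπ Z) := by
  simp [covComplex]

noncomputable def covXIso {A : Type} [CommRing A] (Z : ModuleCat.{0} A) (n : ℕ) :
    (covComplex Z).X (n + 2) ≅ cov (Limits.kernel ((covComplex Z).d (n + 1) n)) :=
  ChainComplex.mk'XIso _ _ _ _ n

lemma covXIso_d {A : Type} [CommRing A] (Z : ModuleCat.{0} A) (n : ℕ) :
    (covComplex Z).d (n + 2) (n + 1) = (covXIso Z n).hom ≫ covd ((covComplex Z).d (n + 1) n) :=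
  ChainComplex.mk'_d _ _ _ _ n

lemma covComplex_exactAt {A : Type} [CommRing A] (Z : ModuleCat.{0} A) (n : ℕ) :
    (covComplex Z).ExactAt (n + 1) := by
  rw [HomologicalComplex.exactAt_iff' _ (n + 1 + 1) (n + 1) n (by simp) (by simp)]
  refine (ShortComplex.exact_iff_of_iso ?_).2 (covd_exact ((covComplex Z).d (n + 1) n))
  exact ShortComplex.isoMk (covXIso Z n) (Iso.refl _) (Iso.refl _)
    ((covXIso_d Z n).symm.trans (Category.comp_id _).symm)
    ((Category.id_comp _).trans (Category.comp_id _).symm)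

lemma finite_kernel {A : Type} [CommRing A] [IsNoetherianRing A] {X Y : ModuleCat.{0} A}
    (f : X ⟶ Y) [Module.Finite A X] : Module.Finite A (Limits.kernel f : ModuleCat A) :=
  Module.Finite.of_injective (Limits.kernel.ι f).hom ((ModuleCat.mono_iff_injective _).1 inferInstance)

lemma covComplex_spec {A : Type} [CommRing A] (Z : ModuleCat.{0} A) (n : ℕ) :
    ∃ M, Nonempty ((covComplex Z).X n ≅ cov M) ∧
      (IsNoetherianRing A → Module.Finite A Z → Module.Finite A M) := by
  induction n using Nat.strong_induction_on with
  | _ n ih =>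
  match n with
  | 0 => exact ⟨Z, ⟨Iso.refl _⟩, fun _ h => h⟩
  | 1 => exact ⟨_, ⟨Iso.refl _⟩, fun _ h =>
      have := (cov_spec Z).2.2.2 h
      finite_kernel _⟩
  | n + 2 =>
    refine ⟨_, ⟨covXIso Z n⟩, fun hA h => ?_⟩
    obtain ⟨M, ⟨e⟩, hM⟩ := ih (n + 1) (by omega)
    have := (cov_spec M).2.2.2 (hM hA h)
    have := Module.Finite.equiv e.toLinearEquiv.symm
    exact finite_kernel _

noncomputable def covπ0 {A : Type} [CommRing A] (Z : ModuleCat.{0} A) :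
    covComplex Z ⟶ (ChainComplex.single₀ (ModuleCat.{0} A)).obj Z :=
  (ChainComplex.toSingle₀Equiv _ _).symm ⟨covπ Z, by
          rw [covComplex_d]; exact covd_comp (covπ Z)⟩

lemma covπ0_f {A : Type} [CommRing A] (Z : ModuleCat.{0} A) : (covπ0 Z).f 0 = covπ Z :=
  ChainComplex.toSingle₀Equiv_symm_apply_f_zero (C := covComplex Z) (covπ Z) _

noncomputable def covRes {A : Type} [CommRing A] (Z : ModuleCat.{0} A) :
    ProjectiveResolution Z where
  complex := covComplex Z
  projective n := by
    obtain ⟨M, ⟨e⟩, -⟩ := covComplex_spec Z n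
    exact Projective.of_iso e.symm (cov_spec M).1
  π := covπ0 Z
  quasiIso := ⟨fun n => by
    cases n
    · rw [ChainComplex.quasiIsoAt₀_iff, ShortComplex.quasiIso_iff_of_zeros']
      · refine (ShortComplex.exact_and_epi_g_iff_of_iso ?_).2
          ⟨covd_exact (covπ Z), by dsimp; infer_instance⟩
        exact ShortComplex.isoMk (Iso.refl _) (Iso.refl _) (Iso.refl _)
          ((Category.id_comp _).trans ((covComplex_d Z).symm.trans (Category.comp_id _).symm))
          ((Category.id_comp _).trans ((covπ0_f Z).symm.trans
            (Category.comp_id _).symm))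
      all_goals rfl
    · rw [quasiIsoAt_iff_exactAt']
      · apply covComplex_exactAt
      · apply ChainComplex.exactAt_succ_single_obj⟩

/-- scalar extension comparison -/
noncomputable def bcEquiv (R S : Type) [CommRing R] [CommRing S] [Algebra R S]
    (N : Type) [AddCommGroup N] [Module S N] [Module R N] [IsScalarTower R S N]
    (X : Type) [AddCommGroup X] [Module R X] :
    TensorProduct R X N ≃+ TensorProduct S (TensorProduct R S X) N :=
  (TensorProduct.comm R X N).toAddEquiv.trans
    ((TensorProduct.AlgebraTensorModule.cancelBaseChange R S S N X).symm.toAddEquiv.trans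
      (TensorProduct.comm S N _).toAddEquiv)

lemma bcEquiv_tmul (R S : Type) [CommRing R] [CommRing S] [Algebra R S]
    (N : Type) [AddCommGroup N] [Module S N] [Module R N] [IsScalarTower R S N]
    (X : Type) [AddCommGroup X] [Module R X] (x : X) (n : N) :
    bcEquiv R S N X (TensorProduct.tmul R x n) =
      TensorProduct.tmul S (TensorProduct.tmul R (1 : S) x) n := by
  simp [bcEquiv]

lemma bcEquiv_nat (R S : Type) [CommRing R] [CommRing S] [Algebra R S]
    (N : Type) [AddCommGroup N] [Module S N] [Module R N] [IsScalarTower R S N]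
    {X X' : Type} [AddCommGroup X] [Module R X] [AddCommGroup X'] [Module R X'] (f : X →ₗ[R] X')
    (z : TensorProduct R X N) :
    bcEquiv R S N X' (f.rTensor N z) = (f.baseChange S).rTensor N (bcEquiv R S N X z) := by
  induction z with
  | zero => simp
  | add a b ha hb => simp only [map_add, ha, hb]
  | tmul x n => simp [bcEquiv_tmul]

def kerAddEquiv {R S M M' L L' : Type} [CommRing R] [CommRing S] [AddCommMonoid M] [AddCommMonoid M']
    [AddCommMonoid L] [AddCommMonoid L'] [Module R M] [Module R M'] [Module S L] [Module S L']
    (f : M →ₗ[R] M') (g : L →ₗ[S] L') (e : M ≃+ L) (e' : M' ≃+ L')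
    (h : ∀ z, e' (f z) = g (e z)) : LinearMap.ker f ≃+ LinearMap.ker g where
  toFun x := ⟨e x, by rw [LinearMap.mem_ker, ← h, x.2, map_zero]⟩
  invFun x := ⟨e.symm x, by
    rw [LinearMap.mem_ker]
    apply e'.injective
    rw [h, e.apply_symm_apply, x.2, map_zero]⟩
  left_inv x := by simp
  right_inv x := by simp
  map_add' x y := by ext; simp

/-- The short complex attached to an exact pair of linear maps. -/
noncomputable abbrev mkT {A X Y Z : Type} [CommRing A] [AddCommGroup X] [AddCommGroup Y] [AddCommGroup Z]
    [Module A X] [Module A Y] [Module A Z] (f : X →ₗ[A] Y) (g : Y →ₗ[A] Z)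
    (h : Function.Exact f g) : ShortComplex (ModuleCat.{0} A) :=
  .mk (ModuleCat.ofHom f) (ModuleCat.ofHom g)
    (ModuleCat.hom_ext (LinearMap.ext fun x => h.apply_apply_eq_zero x))

lemma mkT_shortExact {A X Y Z : Type} [CommRing A] [AddCommGroup X] [AddCommGroup Y]
    [AddCommGroup Z]
    [Module A X] [Module A Y] [Module A Z] (f : X →ₗ[A] Y) (g : Y →ₗ[A] Z)
    (h : Function.Exact f g) (hf : Function.Injective f) (hg : Function.Surjective g) :
    (mkT f g h).ShortExact :=
  { exact := (ShortComplex.ShortExact.moduleCat_exact_iff_function_exact _).2 h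
    mono_f := (ModuleCat.mono_iff_injective _).2 hf
    epi_g := (ModuleCat.epi_iff_surjective _).2 hg }

noncomputable def kerBC (R S : Type) [CommRing R] [CommRing S] [Algebra R S]
    (N : Type) [AddCommGroup N] [Module S N] [Module R N] [IsScalarTower R S N]
    {K L : Type} [AddCommGroup K] [Module R K] [AddCommGroup L] [Module R L] (f : K →ₗ[R] L) :
    LinearMap.ker (f.rTensor N) ≃+ LinearMap.ker ((f.baseChange S).rTensor N) :=
  kerAddEquiv (f.rTensor N) ((f.baseChange S).rTensor N)
    (bcEquiv R S N K) (bcEquiv R S N L) (bcEquiv_nat R S N f)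

lemma free_cover (R : Type) [CommRing R] (X : Type) [AddCommGroup X] [Module R X] :
    ∃ (K L : Type) (_ : AddCommGroup K) (_ : AddCommGroup L) (_ : Module R K) (_ : Module R L)
      (f : K →ₗ[R] L) (g : L →ₗ[R] X), Module.Flat R L ∧ Function.Injective f ∧
      Function.Exact f g ∧ Function.Surjective g :=
  ⟨LinearMap.ker (Finsupp.linearCombination R (id : X → X)), X →₀ R, inferInstance, inferInstance,
    inferInstance, inferInstance, Submodule.subtype _, Finsupp.linearCombination R id,
    inferInstance, Subtype.val_injective, LinearMap.exact_subtype_ker_map _,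
    Finsupp.linearCombination_id_surjective R X⟩

lemma main_iso (R S : Type) [CommRing R] [CommRing S] [Algebra R S] [Module.Flat R S]
    (N : Type) [AddCommGroup N] [Module S N] [Module R N] [IsScalarTower R S N] (i : ℕ) :
    ∀ (X : Type) [AddCommGroup X] [Module R X],
    Nonempty (((Tor (ModuleCat R) i).obj (ModuleCat.of R X)).obj (ModuleCat.of R N) ≃+
      ((Tor (ModuleCat S) i).obj (ModuleCat.of S (TensorProduct R S X))).obj (ModuleCat.of S N)) := by
  induction i with
  | zero =>
    intro X _ _
    obtain ⟨e⟩ := tor_zero (ModuleCat.of R X) (ModuleCat.of R N)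
    obtain ⟨e'⟩ := tor_zero (ModuleCat.of S (TensorProduct R S X)) (ModuleCat.of S N)
    exact ⟨e.toLinearEquiv.toAddEquiv.trans ((bcEquiv R S N X).trans
      e'.toLinearEquiv.symm.toAddEquiv)⟩
  | succ i ih =>
    intro X _ _
    obtain ⟨K, L, _, _, _, _, f, p, hL, hinj, hex, hp⟩ := free_cover R X
    have hT := mkT_shortExact f p hex hinj hp
    have hex' : Function.Exact (f.baseChange S) (p.baseChange S) :=
      Module.Flat.lTensor_exact S hex
    have hinj' : Function.Injective (f.baseChange S) :=
      Module.Flat.lTensor_preserves_injective_linearMap (M := S) _ hinj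
    have hp' : Function.Surjective (p.baseChange S) := LinearMap.lTensor_surjective S hp
    have hT' := mkT_shortExact (f.baseChange S) (p.baseChange S) hex' hinj' hp'
    have : Module.Flat R (mkT f p hex).X₂ := hL
    have : Module.Flat S (mkT (f.baseChange S) (p.baseChange S) hex').X₂ :=
      inferInstanceAs (Module.Flat S (TensorProduct R S L))
    cases i with
    | zero =>
      obtain ⟨e⟩ := tor_one hT (ModuleCat.of R N)
      obtain ⟨e'⟩ := tor_one hT' (ModuleCat.of S N)
      let k := kerBC R S N f
      exact ⟨e.toAddEquiv.trans (AddEquiv.trans k e'.symm.toAddEquiv)⟩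
    | succ i =>
      obtain ⟨e⟩ := tor_shift hT (ModuleCat.of R N) i
      obtain ⟨e'⟩ := tor_shift hT' (ModuleCat.of S N) i
      obtain ⟨k⟩ := ih K
      exact ⟨e.toLinearEquiv.toAddEquiv.trans (AddEquiv.trans k e'.toLinearEquiv.symm.toAddEquiv)⟩

lemma residue_iso (R : Type) [CommRing R] [IsLocalRing R]
    (S : Type) [CommRing S] [IsLocalRing S] [Algebra R S]
    (hms : (maximalIdeal R).map (algebraMap R S) = maximalIdeal S) :
    Nonempty (TensorProduct R S (ResidueField R) ≃ₗ[S] ResidueField S) := by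
  have e := (Algebra.TensorProduct.quotIdealMapEquivTensorQuot S (maximalIdeal R)).symm.toLinearEquiv
  exact ⟨e ≪≫ₗ Submodule.quotEquivOfEq _ _ hms⟩

lemma main_aux (R : Type) [CommRing R] [IsLocalRing R]
    (S : Type) [CommRing S] [IsNoetherianRing S] [IsLocalRing S] [Algebra R S]
    [Module.Flat R S]
    (hms : (maximalIdeal R).map (algebraMap R S) = maximalIdeal S)
    (N : Type) [AddCommGroup N] [Module S N] [Module R N] [IsScalarTower R S N]
    [Module.Finite S N] :
    (∀ i : ℕ,
      Nonempty (↥(torGroup R i (ResidueField R) N) ≃+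
        ↥(torGroup S i (ResidueField S) N))) ∧
    (∀ n : ℕ, flatDimLE R N n ↔ projDimLE S N n) := by
  have h1 : ∀ i : ℕ, Nonempty (↥(torGroup R i (ResidueField R) N) ≃+
        ↥(torGroup S i (ResidueField S) N)) := by
    intro i
    obtain ⟨e⟩ := main_iso R S N i (ResidueField R)
    obtain ⟨r⟩ := residue_iso R S hms
    let e' := ((Tor (ModuleCat S) i).mapIso r.toModuleIso).app (ModuleCat.of S N)
    exact ⟨e.trans e'.toLinearEquiv.toAddEquiv⟩
  refine ⟨h1, fun n => ⟨fun h X i hi => ?_, fun h X i hi => ?_⟩⟩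
  · obtain ⟨j, rfl⟩ : ∃ j, i = j + 1 := ⟨i - 1, by omega⟩
    have hs := h (ModuleCat.of R (ResidueField R)) (j + 1) hi
    obtain ⟨e⟩ := h1 (j + 1)
    have hs' : Subsingleton (torGroup S (j + 1) (ResidueField S) N) :=
      e.toEquiv.subsingleton_congr.1 hs
    refine ext_of_tor (covRes (ModuleCat.of S N)) ?_ ?_ j hs' X
    · intro i
      obtain ⟨M, ⟨e⟩, hM⟩ := covComplex_spec (ModuleCat.of S N) i
      have := (cov_spec M).2.2.2 (hM inferInstance inferInstance)
      exact Module.Finite.equiv e.toLinearEquiv.symm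
    · intro i
      obtain ⟨M, ⟨e⟩, hM⟩ := covComplex_spec (ModuleCat.of S N) i
      have := (cov_spec M).2.2.1
      exact Module.Free.of_equiv e.toLinearEquiv.symm
  · obtain ⟨j, rfl⟩ : ∃ j, i = j + 1 := ⟨i - 1, by omega⟩
    obtain ⟨e⟩ := main_iso R S N (j + 1) X
    exact e.toEquiv.subsingleton_congr.2
      (tor_of_ext _ j (fun X => h X _ hi) (ModuleCat.of S (TensorProduct R S X)))
end Aux

/-- For a flat local homomorphism `R → S` of Noetherian local rings with `mS = n` and a
finitely generated `S`-module `N`, `Tor_i^R(k, N) ≅ Tor_i^S(ℓ, N)` for all `i`; consequently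
the flat dimension of `N` over `R` equals its projective dimension over `S`. -/
theorem stmt_12 (R : Type) [CommRing R] [IsNoetherianRing R] [IsLocalRing R]
    (S : Type) [CommRing S] [IsNoetherianRing S] [IsLocalRing S] [Algebra R S]
    [Module.Flat R S] [IsLocalHom (algebraMap R S)]
    (hms : (maximalIdeal R).map (algebraMap R S) = maximalIdeal S)
    (N : Type) [AddCommGroup N] [Module S N] [Module.Finite S N] :
    (∀ i : ℕ,
      Nonempty (↥(torGroup R i (ResidueField R) (Restrict (algebraMap R S) N)) ≃+
        ↥(torGroup S i (ResidueField S) N))) ∧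
    (∀ n : ℕ, flatDimLE R (Restrict (algebraMap R S) N) n ↔ projDimLE S N n) := by
  letI : Module S (Restrict (algebraMap R S) N) := inferInstanceAs (Module S N)
  haveI : Module.Finite S (Restrict (algebraMap R S) N) := inferInstanceAs (Module.Finite S N)
  haveI : IsScalarTower R S (Restrict (algebraMap R S) N) := by
    refine ⟨fun r s n => ?_⟩
    change (r • s) • (show N from n) = algebraMap R S r • s • (show N from n)
    rw [Algebra.smul_def, mul_smul]
  exact main_aux R S hms (Restrict (algebraMap R S) N)
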